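/- Assume the unimodality hypothesis. If L₀ < 0, L₁ < 0 and δ(p*) ≤ 0, then the ratio p ↦ ψ(p)/φ(p) is monotone nonincreasing on (0,1). (Theorem 2.1, Case 4(a).) -/

import Mathlib

open Set Filter Topology MeasureTheory intervalIntegral

/-- Cauchy's mean value theorem on a subinterval of `(0, 1)`, in quotient form. -/
theorem exists_sub_eq_ratio_mul_sub {φ ψ φ' ψ' : ℝ → ℝ}
    (hφd : ∀ p ∈ Ioo (0:ℝ) 1, HasDerivAt φ (φ' p) p)
    (hψd : ∀ p ∈ Ioo (0:ℝ) 1, HasDerivAt ψ (ψ' p) p)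
    (hφ'pos : ∀ p ∈ Ioo (0:ℝ) 1, 0 < φ' p)
    {a b : ℝ} (ha : 0 < a) (hab : a < b) (hb : b < 1) :
    ∃ c ∈ Ioo a b, ψ b - ψ a = ψ' c / φ' c * (φ b - φ a) := by
  have hsub : Icc a b ⊆ Ioo (0:ℝ) 1 := fun x hx => ⟨ha.trans_le hx.1, hx.2.trans_lt hb⟩
  obtain ⟨c, hc, h⟩ := exists_ratio_hasDerivAt_eq_ratio_slope ψ ψ' hab
    (fun x hx => (hψd x (hsub hx)).continuousAt.continuousWithinAt)
    (fun x hx => hψd x (hsub (Ioo_subset_Icc_self hx))) φ φ'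
    (fun x hx => (hφd x (hsub hx)).continuousAt.continuousWithinAt)
    (fun x hx => hφd x (hsub (Ioo_subset_Icc_self hx)))
  have hne := (hφ'pos c (hsub (Ioo_subset_Icc_self hc))).ne'
  refine ⟨c, hc, ?_⟩
  field_simp
  linarith

theorem stmt7
    (φ ψ φ' ψ' r δ : ℝ → ℝ)
    (hφd : ∀ p ∈ Ioo (0:ℝ) 1, HasDerivAt φ (φ' p) p)
    (hψd : ∀ p ∈ Ioo (0:ℝ) 1, HasDerivAt ψ (ψ' p) p)
    (hφ'pos : ∀ p ∈ Ioo (0:ℝ) 1, 0 < φ' p)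
    (hψ'pos : ∀ p ∈ Ioo (0:ℝ) 1, 0 < ψ' p)
    (hr : ∀ p ∈ Ioo (0:ℝ) 1, r p = ψ' p / φ' p)
    (hrc : ContinuousOn r (Ioo 0 1))
    (lX lY : ℝ)
    (hlX : Tendsto φ (𝓝[>] (0:ℝ)) (𝓝 lX))
    (hlY : Tendsto ψ (𝓝[>] (0:ℝ)) (𝓝 lY))
    (hlX0 : 0 ≤ lX) (hlY0 : 0 ≤ lY)
    (hδ : ∀ p ∈ Ioo (0:ℝ) 1, δ p = φ p * r p - ψ p)
    (pstar : ℝ) (hpstar : pstar ∈ Ioo (0:ℝ) 1)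
    (hrup : MonotoneOn r (Ioo 0 pstar))
    (hrdown : AntitoneOn r (Ioo pstar 1))
    (L₀ L₁ : EReal)
    (hL₀ : Tendsto (fun q => (δ q : EReal)) (𝓝[>] (0:ℝ)) (𝓝 L₀))
    (hL₁ : Tendsto (fun q => (δ q : EReal)) (𝓝[<] (1:ℝ)) (𝓝 L₁))
    (h0 : L₀ < 0) (h1 : L₁ < 0) (hstar : δ pstar ≤ 0) :
    AntitoneOn (fun t => ψ t / φ t) (Ioo 0 1) := by
  have hφmono : StrictMonoOn φ (Ioo 0 1) := by
    refine strictMonoOn_of_deriv_pos (convex_Ioo 0 1)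
      (fun x hx => (hφd x hx).continuousAt.continuousWithinAt) fun x hx => ?_
    rw [interior_Ioo] at hx
    rw [(hφd x hx).deriv]
    exact hφ'pos x hx
  have hφpos : ∀ p ∈ Ioo (0:ℝ) 1, 0 < φ p := by
    intro p hp
    have hhalf : p / 2 ∈ Ioo (0:ℝ) 1 := ⟨by linarith [hp.1], by linarith [hp.1, hp.2]⟩
    have hle : lX ≤ φ (p / 2) := by
      refine le_of_tendsto hlX ?_
      filter_upwards [Ioo_mem_nhdsGT hhalf.1] with x hx
      exact (hφmono ⟨hx.1, hx.2.trans hhalf.2⟩ hhalf hx.2).le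
    have hlt := hφmono hhalf hp (by linarith [hp.1])
    linarith
  have hrup' : MonotoneOn r (insert pstar (Ioo 0 pstar)) := by
    refine hrup.insert_of_continuousWithinAt ?_
      ((hrc pstar hpstar).mono fun x hx => ⟨hx.1, hx.2.trans hpstar.2⟩)
    rw [← mem_closure_iff_clusterPt, closure_Ioo hpstar.1.ne]
    exact right_mem_Icc.2 hpstar.1.le
  have hrdown' : AntitoneOn r (insert pstar (Ioo pstar 1)) := by
    refine (hrdown.dual_right.insert_of_continuousWithinAt ?_
      ((hrc pstar hpstar).mono fun x hx => ⟨hpstar.1.trans hx.1, hx.2⟩)).dual_right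
    rw [← mem_closure_iff_clusterPt, closure_Ioo hpstar.2.ne]
    exact left_mem_Icc.2 hpstar.2.le
  have hδle : ∀ p ∈ Ioo (0:ℝ) 1, δ p ≤ δ pstar := by
    intro p hp
    have hφp := hφpos p hp
    have hφs := hφpos pstar hpstar
    rcases lt_trichotomy p pstar with h | rfl | h
    · obtain ⟨c, hc, hmv⟩ := exists_sub_eq_ratio_mul_sub hφd hψd hφ'pos hp.1 h hpstar.2
      rw [← hr c ⟨hp.1.trans hc.1, hc.2.trans hpstar.2⟩] at hmv
      have hrp := hrup' (.inr ⟨hp.1, h⟩) (.inl rfl) h.le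
      have hrc' := hrup' (.inr ⟨hp.1.trans hc.1, hc.2⟩) (.inl rfl) hc.2.le
      have hφlt := hφmono hp hpstar h
      rw [hδ p hp, hδ pstar hpstar]
      nlinarith [mul_le_mul_of_nonneg_left hrp hφp.le,
        mul_le_mul_of_nonneg_right hrc' (sub_pos.2 hφlt).le]
    · exact le_rfl
    · obtain ⟨c, hc, hmv⟩ := exists_sub_eq_ratio_mul_sub hφd hψd hφ'pos hpstar.1 h hp.2
      rw [← hr c ⟨hpstar.1.trans hc.1, hc.2.trans hp.2⟩] at hmv
      have hrp := hrdown' (.inl rfl) (.inr ⟨h, hp.2⟩) h.le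
      have hrc' := hrdown' (.inr ⟨hc.1, hc.2.trans hp.2⟩) (.inr ⟨h, hp.2⟩) hc.2.le
      have hφlt := hφmono hpstar hp h
      rw [hδ p hp, hδ pstar hpstar]
      nlinarith [mul_le_mul_of_nonneg_left hrp hφs.le,
        mul_le_mul_of_nonneg_right hrc' (sub_pos.2 hφlt).le]
  have hderiv : ∀ p ∈ Ioo (0:ℝ) 1, HasDerivAt (fun t => ψ t / φ t)
      ((ψ' p * φ p - ψ p * φ' p) / φ p ^ 2) p :=
    fun p hp => (hψd p hp).fun_div (hφd p hp) (hφpos p hp).ne'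
  refine antitoneOn_of_deriv_nonpos (convex_Ioo 0 1)
    (fun x hx => (hderiv x hx).continuousAt.continuousWithinAt)
    (fun x hx => (hderiv x (interior_subset hx)).differentiableAt.differentiableWithinAt)
    fun p hp => ?_
  rw [interior_Ioo] at hp
  rw [(hderiv p hp).deriv]
  have hne := (hφ'pos p hp).ne'
  have hnum : ψ' p * φ p - ψ p * φ' p = φ' p * δ p := by
    rw [hδ p hp, hr p hp]
    field_simp
  rw [hnum]
  exact div_nonpos_of_nonpos_of_nonneg
    (mul_nonpos_of_nonneg_of_nonpos (hφ'pos p hp).le ((hδle p hp).trans hstar)) (sq_nonneg _)
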